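/- arXiv:2203.07751 — 6 statements merged into one kernel-verified Lean document; each statement's English description precedes it below -/
import Mathlib

section
/- Let J₂ₙ ∈ ℂ^{2n×2n} and J₂ₖ ∈ ℂ^{2k×2k} be invertible skew-Hermitian matrices, let Q₂ ∈ ℂ^{2n×2k} be (J₂ₙ,J₂ₖ)-symplectic, and set Q₁* = Q₂^{-L} = J₂ₖ⁻¹ Q₂* J₂ₙ. Then J₂ₖ Q₁* − Q₂* J₂ₙ = 0, and consequently the symplectic inverse of the block matrix Q_E = [[Q₁, 0],[0, Q₂]] with respect to (K̃₄ₙ, K̃₄ₖ) is block diagonal: Q_E^{-L} = [[Q₂*, 0],[0, Q₁*]]. -/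
open Matrix

/-- If `Q₂` is `(J₂ₙ, J₂ₖ)`-symplectic and `Q₁ᴴ = Q₂^{-L} = J₂ₖ⁻¹ Q₂ᴴ J₂ₙ`, then
`J₂ₖ Q₁ᴴ − Q₂ᴴ J₂ₙ = 0`, and consequently the symplectic inverse of
`Q_E = [[Q₁,0],[0,Q₂]]` with respect to `(K̃₄ₙ, K̃₄ₖ)` is the block diagonal
matrix `[[Q₂ᴴ, 0],[0, Q₁ᴴ]]`. -/
theorem symplectic_inverse_block_diagonal_of_special_choice
    (n k : ℕ)
    (Jn : Matrix (Fin (2 * n)) (Fin (2 * n)) ℂ)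
    (Jk : Matrix (Fin (2 * k)) (Fin (2 * k)) ℂ)
    (hJnInv : IsUnit Jn) (hJkInv : IsUnit Jk)
    (hJnSkew : Jnᴴ = -Jn) (hJkSkew : Jkᴴ = -Jk)
    (Q₁ Q₂ : Matrix (Fin (2 * n)) (Fin (2 * k)) ℂ)
    (hQ₂ : Q₂ᴴ * Jn * Q₂ = Jk)
    (hQ₁ : Q₁ᴴ = Jk⁻¹ * Q₂ᴴ * Jn) :
    Jk * Q₁ᴴ - Q₂ᴴ * Jn = 0 ∧
    (Matrix.fromBlocks (0 : Matrix (Fin (2 * k)) (Fin (2 * k)) ℂ) 1 (-1) Jk)⁻¹ *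
        (Matrix.fromBlocks Q₁ 0 0 Q₂)ᴴ *
        Matrix.fromBlocks (0 : Matrix (Fin (2 * n)) (Fin (2 * n)) ℂ) 1 (-1) Jn =
      Matrix.fromBlocks Q₂ᴴ 0 0 Q₁ᴴ := by
  have hJ : Jk * Q₁ᴴ = Q₂ᴴ * Jn := by
    rw [hQ₁, Matrix.mul_assoc, Matrix.mul_nonsing_inv_cancel_left _ _
      ((Matrix.isUnit_iff_isUnit_det Jk).mp hJkInv)]
  have hK : (fromBlocks (0 : Matrix (Fin (2 * k)) (Fin (2 * k)) ℂ) 1 (-1) Jk)⁻¹ =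
      fromBlocks Jk (-1) 1 0 :=
    Matrix.inv_eq_left_inv (by simp [fromBlocks_multiply])
  refine ⟨sub_eq_zero.mpr hJ, ?_⟩
  rw [hK, fromBlocks_conjTranspose, fromBlocks_multiply, fromBlocks_multiply]
  simp [hJ]
end

section
/- (Interpolatory structure-preserving MOR without dissipation.) Let J₂ₙ ∈ ℂ^{2n×2n} and J₂ₖ ∈ ℂ^{2k×2k} be invertible skew-Hermitian matrices, H ∈ ℝ^{2n×2n} symmetric positive definite, B ∈ ℝ^{2n×p}. Let Q ∈ ℂ^{2n×2k} be (J₂ₙ⁻¹,J₂ₖ⁻¹)-symplectic, i.e. Q* J₂ₙ⁻¹ Q = J₂ₖ⁻¹, with symplectic inverse Q^{-L} = J₂ₖ Q* J₂ₙ⁻¹, and define Ĥ = Q* H Q and B̂ = Q^{-L} B. Let u₁,…,u_M ∈ ℝ^p and s₁,…,s_M ∈ ℂ be given such that for each m the matrices s_m I₂ₙ − J₂ₙH and s_m I₂ₖ − J₂ₖĤ are invertible. If the range of B is contained in the range of Q, and (s_m I₂ₙ − J₂ₙH)⁻¹ B u_m lies in the range of Q for each m = 1,…,M, then for each m: Bᵀ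 H (s_m I₂ₙ − J₂ₙH)⁻¹ B u_m = B̂* Ĥ (s_m I₂ₖ − J₂ₖĤ)⁻¹ B̂ u_m, i.e. the transfer function G_r of the reduced port-Hamiltonian system interpolates the transfer function G of the full system at the points s_m along the directions u_m. -/
open Matrix

namespace Matrix

variable {R : Type*} [CommRing R] {m n p : Type*} [Fintype m] [Fintype n] [DecidableEq n]

/-- A left inverse of `Q`, followed by `Q`, fixes every matrix whose range lies in that of `Q`. -/
theorem mul_mul_eq_of_range_le_of_mul_eq_one [Fintype p] {Q : Matrix m n R} {L : Matrix n m R}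
    (hL : L * Q = 1) {B : Matrix m p R} (hB : ∀ v : p → R, ∃ w : n → R, B *ᵥ v = Q *ᵥ w) :
    Q * (L * B) = B := by
  classical
  refine ext_of_mulVec_single fun i => ?_
  obtain ⟨w, hw⟩ := hB (Pi.single i 1)
  rw [← mulVec_mulVec, ← mulVec_mulVec, hw, mulVec_mulVec w L Q, hL, one_mulVec]

/-- If the resolvent vector of `A` at `b` is `Q *ᵥ w`, then `w` is the resolvent vector of the
compression `L * A * Q` at `L *ᵥ b`, where `L` is a left inverse of `Q`. -/
theorem resolvent_compression_mulVec [DecidableEq m] {Q : Matrix m n R} {L : Matrix n m R}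
    (hL : L * Q = 1) {A : Matrix m m R} {s : R} (hA : IsUnit (s • (1 : Matrix m m R) - A))
    (hr : IsUnit (s • (1 : Matrix n n R) - L * A * Q)) {b : m → R} {w : n → R}
    (hw : (s • (1 : Matrix m m R) - A)⁻¹ *ᵥ b = Q *ᵥ w) :
    (s • (1 : Matrix n n R) - L * A * Q)⁻¹ *ᵥ (L *ᵥ b) = w := by
  have hb : b = (s • (1 : Matrix m m R) - A) *ᵥ (Q *ᵥ w) := by
    rw [← hw, mulVec_mulVec, mul_nonsing_inv _ ((isUnit_iff_isUnit_det _).1 hA), one_mulVec]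
  have hc : L *ᵥ b = (s • (1 : Matrix n n R) - L * A * Q) *ᵥ w := by
    rw [hb, mulVec_mulVec, mulVec_mulVec]
    congr 1
    rw [Matrix.mul_sub, Matrix.sub_mul, Matrix.mul_smul, Matrix.mul_one, Matrix.smul_mul, hL]
  rw [hc, mulVec_mulVec, nonsing_inv_mul _ ((isUnit_iff_isUnit_det _).1 hr), one_mulVec]

end Matrix

/-- Interpolatory structure-preserving MOR for pH systems without dissipation.
If `Q` is `(J₂ₙ⁻¹, J₂ₖ⁻¹)`-symplectic, `ran B ⊆ ran Q`, and each
`(s_m I − J₂ₙ H)⁻¹ B u_m ∈ ran Q`, then the reduced system with `Ĥ = Qᴴ H Q`,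
`B̂ = Q^{-L} B` interpolates the full transfer function:
`G(s_m) u_m = G_r(s_m) u_m`. -/
theorem interpolation_no_dissipation
    (n k p M : ℕ)
    (Jn : Matrix (Fin (2 * n)) (Fin (2 * n)) ℂ)
    (Jk : Matrix (Fin (2 * k)) (Fin (2 * k)) ℂ)
    (hJnInv : IsUnit Jn) (hJkInv : IsUnit Jk)
    (hJnSkew : Jnᴴ = -Jn) (hJkSkew : Jkᴴ = -Jk)
    (H : Matrix (Fin (2 * n)) (Fin (2 * n)) ℝ) (hH : H.PosDef)
    (B : Matrix (Fin (2 * n)) (Fin p) ℝ)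
    (Q : Matrix (Fin (2 * n)) (Fin (2 * k)) ℂ)
    (hQ : Qᴴ * Jn⁻¹ * Q = Jk⁻¹)
    -- complexifications of the real data
    (Hc : Matrix (Fin (2 * n)) (Fin (2 * n)) ℂ) (hHc : Hc = H.map (fun a => (a : ℂ)))
    (Bc : Matrix (Fin (2 * n)) (Fin p) ℂ) (hBc : Bc = B.map (fun a => (a : ℂ)))
    -- the symplectic inverse and the reduced matrices
    (QL : Matrix (Fin (2 * k)) (Fin (2 * n)) ℂ) (hQL : QL = Jk * Qᴴ * Jn⁻¹)
    (Hhat : Matrix (Fin (2 * k)) (Fin (2 * k)) ℂ) (hHhat : Hhat = Qᴴ * Hc * Q)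
    (Bhat : Matrix (Fin (2 * k)) (Fin p) ℂ) (hBhat : Bhat = QL * Bc)
    -- interpolation data
    (u : Fin M → Fin p → ℝ) (s : Fin M → ℂ)
    (hinvF : ∀ m, IsUnit (s m • (1 : Matrix (Fin (2 * n)) (Fin (2 * n)) ℂ) - Jn * Hc))
    (hinvR : ∀ m, IsUnit (s m • (1 : Matrix (Fin (2 * k)) (Fin (2 * k)) ℂ) - Jk * Hhat))
    -- range conditions
    (hranB : ∀ v : Fin p → ℂ, ∃ w : Fin (2 * k) → ℂ, Bc *ᵥ v = Q *ᵥ w)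
    (hranX : ∀ m, ∃ w : Fin (2 * k) → ℂ,
      (s m • (1 : Matrix (Fin (2 * n)) (Fin (2 * n)) ℂ) - Jn * Hc)⁻¹ *ᵥ
          (Bc *ᵥ fun i => ((u m i : ℝ) : ℂ)) = Q *ᵥ w) :
    ∀ m,
      Bcᵀ *ᵥ (Hc *ᵥ ((s m • (1 : Matrix (Fin (2 * n)) (Fin (2 * n)) ℂ) - Jn * Hc)⁻¹ *ᵥ
          (Bc *ᵥ fun i => ((u m i : ℝ) : ℂ)))) =
      Bhatᴴ *ᵥ (Hhat *ᵥ ((s m • (1 : Matrix (Fin (2 * k)) (Fin (2 * k)) ℂ) - Jk * Hhat)⁻¹ *ᵥ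
          (Bhat *ᵥ fun i => ((u m i : ℝ) : ℂ)))) := by
  intro m
  have hL : QL * Q = 1 := by
    rw [hQL, Matrix.mul_assoc, Matrix.mul_assoc, ← Matrix.mul_assoc Qᴴ, hQ,
      mul_nonsing_inv _ ((isUnit_iff_isUnit_det _).1 hJkInv)]
  have hA : Jk * Hhat = QL * (Jn * Hc) * Q := by
    rw [hQL, hHhat, ← Matrix.mul_assoc _ Jn,
      nonsing_inv_mul_cancel_right _ _ ((isUnit_iff_isUnit_det _).1 hJnInv)]
    simp only [Matrix.mul_assoc]
  have hB : Q * Bhat = Bc := hBhat ▸ mul_mul_eq_of_range_le_of_mul_eq_one hL hranB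
  have hBT : Bcᵀ = Bcᴴ := by
    ext i j
    simp [hBc]
  obtain ⟨w, hw⟩ := hranX m
  have hr := hinvR m
  rw [hA] at hr
  rw [hw, hA, hBhat, ← mulVec_mulVec _ QL, resolvent_compression_mulVec hL (hinvF m) hr hw,
    ← hBhat, hBT, ← hB, conjTranspose_mul, hHhat]
  simp only [mulVec_mulVec, Matrix.mul_assoc]
end

section
/- (Interpolatory structure-preserving MOR with dissipation.) Let J₂ₙ ∈ ℂ^{2n×2n} and J₂ₖ ∈ ℂ^{2k×2k} be skew-Hermitian matrices, H ∈ ℝ^{2n×2n} symmetric positive definite, R ∈ ℝ^{2n×2n} symmetric positive semi-definite, B ∈ ℝ^{2n×p}. Let Q₂ ∈ ℂ^{2n×2k} satisfy Q₂* J₂ₙ Q₂ = J₂ₖ and let Q₁ ∈ ℂ^{2n×2k} satisfy Q₁* Q₂ = I₂ₖ. Define Ĥ = Q₁* H Q₁, R̂ = Q₂* R Q₂, B̂ = Q₂* B. Let u₁,…,u_M ∈ ℂ^p and s₁,…,s_M ∈ ℂ be given such that for each m the matrices s_m I₂ₙ − (J₂ₙ − R)H and s_m I₂ₖ − (J₂ₖ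 − R̂)Ĥ are invertible, and set x_m = (s_m I₂ₙ − (J₂ₙ − R)H)⁻¹ B u_m. If the range of B is contained in the range of Q₁, x_m lies in the range of Q₁, and H x_m lies in the range of Q₂ for each m = 1,…,M, then for each m: Bᵀ H x_m = B̂* Ĥ (s_m I₂ₖ − (J₂ₖ − R̂)Ĥ)⁻¹ B̂ u_m, i.e. the transfer function of the reduced port-Hamiltonian system equals that of the full system at the given frequencies along the given directions, G(s_m)u_m = G_r(s_m)u_m. -/
open Matrix

/-- Petrov–Galerkin projection: a state `x = Q₁ w` with `H x ∈ ran Q₂` that solves the full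
shifted pH system projects to a solution `w` of the reduced one, and `H x` is recovered from the
reduced effort `Q₁ᴴ H Q₁ w`. -/
theorem petrovGalerkin_projection {ι κ 𝕜 : Type*} [Fintype ι] [DecidableEq ι]
    [Fintype κ] [DecidableEq κ] [CommRing 𝕜] [StarRing 𝕜]
    {A H : Matrix ι ι 𝕜} {Q₁ Q₂ : Matrix ι κ 𝕜} (hQ : Q₁ᴴ * Q₂ = 1)
    {s : 𝕜} {b : ι → 𝕜} {w v : κ → 𝕜}
    (hsol : (s • (1 : Matrix ι ι 𝕜) - A * H) *ᵥ (Q₁ *ᵥ w) = b)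
    (hHx : H *ᵥ (Q₁ *ᵥ w) = Q₂ *ᵥ v) :
    (s • (1 : Matrix κ κ 𝕜) - (Q₂ᴴ * A * Q₂) * (Q₁ᴴ * H * Q₁)) *ᵥ w = Q₂ᴴ *ᵥ b ∧
      H *ᵥ (Q₁ *ᵥ w) = Q₂ *ᵥ ((Q₁ᴴ * H * Q₁) *ᵥ w) := by
  have hQ' : Q₂ᴴ * Q₁ = 1 := by simpa using congrArg conjTranspose hQ
  have hv : (Q₁ᴴ * H * Q₁) *ᵥ w = v := by
    rw [← mulVec_mulVec, ← mulVec_mulVec, hHx, mulVec_mulVec, hQ, one_mulVec]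
  refine ⟨?_, by rw [hv, hHx]⟩
  rw [← hsol, sub_mulVec, sub_mulVec, ← mulVec_mulVec w, hv, ← mulVec_mulVec _ A H, hHx,
    smul_mulVec, smul_mulVec, one_mulVec, one_mulVec, mulVec_sub, mulVec_smul,
    mulVec_mulVec w, hQ', one_mulVec]
  simp only [mulVec_mulVec, Matrix.mul_assoc]

/-- Interpolatory structure-preserving MOR for pH systems with dissipation.
If `Q₂ᴴ J₂ₙ Q₂ = J₂ₖ`, `Q₁ᴴ Q₂ = I`, `ran B ⊆ ran Q₁`,
`x_m = (s_m I − (J₂ₙ − R)H)⁻¹ B u_m ∈ ran Q₁` and `H x_m ∈ ran Q₂`, then the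
reduced pH system with `Ĥ = Q₁ᴴ H Q₁`, `R̂ = Q₂ᴴ R Q₂`, `B̂ = Q₂ᴴ B` satisfies
`G(s_m) u_m = G_r(s_m) u_m`. -/
theorem interpolation_with_dissipation
    (n k p M : ℕ)
    (Jn : Matrix (Fin (2 * n)) (Fin (2 * n)) ℂ)
    (Jk : Matrix (Fin (2 * k)) (Fin (2 * k)) ℂ)
    (hJnSkew : Jnᴴ = -Jn) (hJkSkew : Jkᴴ = -Jk)
    (H R : Matrix (Fin (2 * n)) (Fin (2 * n)) ℝ)
    (hH : H.PosDef) (hR : R.PosSemidef)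
    (B : Matrix (Fin (2 * n)) (Fin p) ℝ)
    (Q₁ Q₂ : Matrix (Fin (2 * n)) (Fin (2 * k)) ℂ)
    (hQ₂ : Q₂ᴴ * Jn * Q₂ = Jk)
    (hQ₁ : Q₁ᴴ * Q₂ = 1)
    -- complexifications of the real data
    (Hc Rc : Matrix (Fin (2 * n)) (Fin (2 * n)) ℂ)
    (hHc : Hc = H.map (fun a => (a : ℂ))) (hRc : Rc = R.map (fun a => (a : ℂ)))
    (Bc : Matrix (Fin (2 * n)) (Fin p) ℂ) (hBc : Bc = B.map (fun a => (a : ℂ)))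
    -- reduced matrices
    (Hhat : Matrix (Fin (2 * k)) (Fin (2 * k)) ℂ) (hHhat : Hhat = Q₁ᴴ * Hc * Q₁)
    (Rhat : Matrix (Fin (2 * k)) (Fin (2 * k)) ℂ) (hRhat : Rhat = Q₂ᴴ * Rc * Q₂)
    (Bhat : Matrix (Fin (2 * k)) (Fin p) ℂ) (hBhat : Bhat = Q₂ᴴ * Bc)
    -- interpolation data
    (u : Fin M → Fin p → ℂ) (s : Fin M → ℂ)
    (hinvF : ∀ m, IsUnit (s m • (1 : Matrix (Fin (2 * n)) (Fin (2 * n)) ℂ) - (Jn - Rc) * Hc))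
    (hinvR : ∀ m, IsUnit (s m • (1 : Matrix (Fin (2 * k)) (Fin (2 * k)) ℂ) - (Jk - Rhat) * Hhat))
    (x : Fin M → Fin (2 * n) → ℂ)
    (hx : ∀ m, x m =
      (s m • (1 : Matrix (Fin (2 * n)) (Fin (2 * n)) ℂ) - (Jn - Rc) * Hc)⁻¹ *ᵥ (Bc *ᵥ u m))
    -- range conditions
    (hranB : ∀ v : Fin p → ℂ, ∃ w : Fin (2 * k) → ℂ, Bc *ᵥ v = Q₁ *ᵥ w)
    (hranX : ∀ m, ∃ w : Fin (2 * k) → ℂ, x m = Q₁ *ᵥ w)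
    (hranHX : ∀ m, ∃ w : Fin (2 * k) → ℂ, Hc *ᵥ x m = Q₂ *ᵥ w) :
    ∀ m,
      Bcᵀ *ᵥ (Hc *ᵥ x m) =
      Bhatᴴ *ᵥ (Hhat *ᵥ
        ((s m • (1 : Matrix (Fin (2 * k)) (Fin (2 * k)) ℂ) - (Jk - Rhat) * Hhat)⁻¹ *ᵥ
          (Bhat *ᵥ u m))) := by
  intro m
  obtain ⟨w, hw⟩ := hranX m
  obtain ⟨v, hv⟩ := hranHX m
  have hsol : (s m • (1 : Matrix (Fin (2 * n)) (Fin (2 * n)) ℂ) - (Jn - Rc) * Hc) *ᵥ (Q₁ *ᵥ w) =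
      Bc *ᵥ u m := by
    rw [← hw, hx m, mulVec_mulVec,
      mul_nonsing_inv _ ((isUnit_iff_isUnit_det _).mp (hinvF m)), one_mulVec]
  rw [hw] at hv
  obtain ⟨hred, heff⟩ := petrovGalerkin_projection hQ₁ hsol hv
  have hJR : Q₂ᴴ * (Jn - Rc) * Q₂ = Jk - Rhat := by
    rw [Matrix.mul_sub, Matrix.sub_mul, hQ₂, hRhat]
  rw [hJR, ← hHhat, mulVec_mulVec, ← hBhat] at hred
  have hBct : Bcᴴ = Bcᵀ := by
    ext i j
    simp [hBc]
  rw [← hred, mulVec_mulVec w, nonsing_inv_mul _ ((isUnit_iff_isUnit_det _).mp (hinvR m)),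
    one_mulVec, hw, heff, ← hHhat, hBhat, conjTranspose_mul, conjTranspose_conjTranspose, hBct,
    mulVec_mulVec _ Bcᵀ Q₂]
end

section
/- (Two-sided tangential interpolation variant.) Let J₂ₙ ∈ ℂ^{2n×2n} and J₂ₖ ∈ ℂ^{2k×2k} be skew-Hermitian matrices, H ∈ ℝ^{2n×2n} symmetric positive definite, R ∈ ℝ^{2n×2n} symmetric positive semi-definite, B ∈ ℝ^{2n×p}. Let Q₂ ∈ ℂ^{2n×2k} satisfy Q₂* J₂ₙ Q₂ = J₂ₖ and Q₁ ∈ ℂ^{2n×2k} satisfy Q₁* Q₂ = I₂ₖ, and define Ĥ = Q₁* H Q₁, R̂ = Q₂* R Q₂, B̂ = Q₂* B. Let u₁,…,u_M, y₁,…,y_M ∈ ℂ^p and s₁,…,s_M ∈ ℂ be such that for each m the matrices s_m I₂ₙ − (J₂ₙ − R)H and s_m I₂ₖ − (J₂ₖ − R̂)Ĥ are invertible, and set x_m = (s_m I₂ₙ − (J₂ₙ − R)H)⁻¹ B u_m. If for each m = 1,…,M the vector B y_m lies in the range of Q₁, x_m lies in the range of Q₁, and H x_m lies in the range of Q₂,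 then for each m: y_mᵀ Bᵀ H x_m = y_mᵀ B̂* Ĥ (s_m I₂ₖ − (J₂ₖ − R̂)Ĥ)⁻¹ B̂ u_m, i.e. y_mᵀ G(s_m) u_m = y_mᵀ G_r(s_m) u_m. -/
open Matrix

/-- Two-sided tangential interpolation variant: if instead of `ran B ⊆ ran Q₁` we
only assume `B y_m ∈ ran Q₁`, then `y_mᵀ G(s_m) u_m = y_mᵀ G_r(s_m) u_m`. -/
theorem two_sided_interpolation_with_dissipation
    (n k p M : ℕ)
    (Jn : Matrix (Fin (2 * n)) (Fin (2 * n)) ℂ)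
    (Jk : Matrix (Fin (2 * k)) (Fin (2 * k)) ℂ)
    (hJnSkew : Jnᴴ = -Jn) (hJkSkew : Jkᴴ = -Jk)
    (H R : Matrix (Fin (2 * n)) (Fin (2 * n)) ℝ)
    (hH : H.PosDef) (hR : R.PosSemidef)
    (B : Matrix (Fin (2 * n)) (Fin p) ℝ)
    (Q₁ Q₂ : Matrix (Fin (2 * n)) (Fin (2 * k)) ℂ)
    (hQ₂ : Q₂ᴴ * Jn * Q₂ = Jk)
    (hQ₁ : Q₁ᴴ * Q₂ = 1)
    -- complexifications of the real data
    (Hc Rc : Matrix (Fin (2 * n)) (Fin (2 * n)) ℂ)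
    (hHc : Hc = H.map (fun a => (a : ℂ))) (hRc : Rc = R.map (fun a => (a : ℂ)))
    (Bc : Matrix (Fin (2 * n)) (Fin p) ℂ) (hBc : Bc = B.map (fun a => (a : ℂ)))
    -- reduced matrices
    (Hhat : Matrix (Fin (2 * k)) (Fin (2 * k)) ℂ) (hHhat : Hhat = Q₁ᴴ * Hc * Q₁)
    (Rhat : Matrix (Fin (2 * k)) (Fin (2 * k)) ℂ) (hRhat : Rhat = Q₂ᴴ * Rc * Q₂)
    (Bhat : Matrix (Fin (2 * k)) (Fin p) ℂ) (hBhat : Bhat = Q₂ᴴ * Bc)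
    -- interpolation data
    (u y : Fin M → Fin p → ℂ) (s : Fin M → ℂ)
    (hinvF : ∀ m, IsUnit (s m • (1 : Matrix (Fin (2 * n)) (Fin (2 * n)) ℂ) - (Jn - Rc) * Hc))
    (hinvR : ∀ m, IsUnit (s m • (1 : Matrix (Fin (2 * k)) (Fin (2 * k)) ℂ) - (Jk - Rhat) * Hhat))
    (x : Fin M → Fin (2 * n) → ℂ)
    (hx : ∀ m, x m =
      (s m • (1 : Matrix (Fin (2 * n)) (Fin (2 * n)) ℂ) - (Jn - Rc) * Hc)⁻¹ *ᵥ (Bc *ᵥ u m))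
    -- range conditions
    (hranBy : ∀ m, ∃ w : Fin (2 * k) → ℂ, Bc *ᵥ y m = Q₁ *ᵥ w)
    (hranX : ∀ m, ∃ w : Fin (2 * k) → ℂ, x m = Q₁ *ᵥ w)
    (hranHX : ∀ m, ∃ w : Fin (2 * k) → ℂ, Hc *ᵥ x m = Q₂ *ᵥ w) :
    ∀ m,
      y m ⬝ᵥ (Bcᵀ *ᵥ (Hc *ᵥ x m)) =
      y m ⬝ᵥ (Bhatᴴ *ᵥ (Hhat *ᵥ
        ((s m • (1 : Matrix (Fin (2 * k)) (Fin (2 * k)) ℂ) - (Jk - Rhat) * Hhat)⁻¹ *ᵥ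
          (Bhat *ᵥ u m)))) := by
  intro m
  obtain ⟨z, hz⟩ := hranX m
  obtain ⟨w, hw⟩ := hranHX m
  have hQ₁' : Q₂ᴴ * Q₁ = 1 := by
    simpa using congrArg conjTranspose hQ₁
  have hwz : w = Hhat *ᵥ z := by
    calc w = Q₁ᴴ *ᵥ (Q₂ *ᵥ w) := by rw [mulVec_mulVec, hQ₁, one_mulVec]
      _ = Q₁ᴴ *ᵥ (Hc *ᵥ (Q₁ *ᵥ z)) := by rw [← hw, hz]
      _ = Hhat *ᵥ z := by rw [hHhat]; simp only [mulVec_mulVec, Matrix.mul_assoc]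
  have hfull : s m • x m - (Jn - Rc) *ᵥ (Q₂ *ᵥ w) = Bc *ᵥ u m := by
    have h : (s m • (1 : Matrix (Fin (2 * n)) (Fin (2 * n)) ℂ) - (Jn - Rc) * Hc) *ᵥ x m
        = Bc *ᵥ u m := by
      rw [hx m, mulVec_mulVec (Bc *ᵥ u m),
        mul_nonsing_inv _ ((isUnit_iff_isUnit_det _).1 (hinvF m)), one_mulVec]
    rw [← h, sub_mulVec (s m • 1), smul_mulVec, one_mulVec, ← mulVec_mulVec, hw]
  have hJR : Q₂ᴴ * (Jn - Rc) * Q₂ = Jk - Rhat := by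
    rw [Matrix.mul_sub, Matrix.sub_mul, hQ₂, hRhat]
  have hred : (s m • (1 : Matrix (Fin (2 * k)) (Fin (2 * k)) ℂ) - (Jk - Rhat) * Hhat) *ᵥ z
      = Bhat *ᵥ u m := by
    rw [hBhat, ← mulVec_mulVec, ← hfull, mulVec_sub, mulVec_smul, hz, mulVec_mulVec, hQ₁',
      one_mulVec, mulVec_mulVec, mulVec_mulVec, hJR, sub_mulVec, smul_mulVec, one_mulVec,
      ← mulVec_mulVec, ← hwz]
  have hBreal : Bcᴴ = Bcᵀ := by
    ext i j
    simp [hBc]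
  rw [← hred, mulVec_mulVec z,
    nonsing_inv_mul _ ((isUnit_iff_isUnit_det _).1 (hinvR m)), one_mulVec, ← hwz, hw, hBhat,
    conjTranspose_mul, conjTranspose_conjTranspose, ← mulVec_mulVec, hBreal]
end

section
/- (Existence of the symplectic matrices.) Let J₂ₙ ∈ ℂ^{2n×2n} be skew-Hermitian and let V, W ∈ ℂ^{2n×2k}. Assume that the Hermitian matrix i·W* J₂ₙ W ∈ ℂ^{2k×2k} has exactly k positive and k negative eigenvalues (counted with multiplicity), and that V* W has rank 2k. Then there exist matrices Q₁, Q₂ ∈ ℂ^{2n×2k} such that: (i) the range of V is contained in the range of Q₁ and the range of W is contained in the range of Q₂; (ii) Q₁* Q₂ = I₂ₖ (Q₁* is a left inverse of Q₂); and (iii) Q₂* J₂ₙ Q₂ = 𝕁₂ₖ, where 𝕁₂ₖ = [[0, I_k],[−I_k, 0]] is the canonical Poisson matrix (i.e. Q₂ is (J₂ₙ, 𝕁₂ₖ)-symplectic). -/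
open Matrix

/-- If exactly `card α` values of `f` are positive and `card β` are negative, and the index
type is `α ⊕ β`, then the indices can be permuted so that the left summand carries the positive
values and the right summand the negative ones. -/
lemma exists_perm_pos_neg {α β : Type*} [Fintype α] [Fintype β] (f : α ⊕ β → ℝ)
    (hpos : (Finset.univ.filter fun i => 0 < f i).card = Fintype.card α)
    (hneg : (Finset.univ.filter fun i => f i < 0).card = Fintype.card β) :
    ∃ e : Equiv.Perm (α ⊕ β), (∀ a, 0 < f (e (Sum.inl a))) ∧ ∀ b, f (e (Sum.inr b)) < 0 := by
  classical
  have a : α ≃ {i // 0 < f i} :=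
    Fintype.equivOfCardEq (by rw [Fintype.card_subtype, hpos])
  have b : β ≃ {i // f i < 0} :=
    Fintype.equivOfCardEq (by rw [Fintype.card_subtype, hneg])
  have hinj : Function.Injective (Sum.elim (fun x => (a x).1) fun y => (b y).1) := by
    refine Function.Injective.sumElim (Subtype.val_injective.comp a.injective)
      (Subtype.val_injective.comp b.injective) fun x y h => ?_
    have h1 := (a x).2
    have h2 := (b y).2
    rw [h] at h1
    exact lt_asymm h1 h2
  exact ⟨Equiv.ofBijective _ (Finite.injective_iff_bijective.mp hinj),
    fun x => (a x).2, fun y => (b y).2⟩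

/-- A Hermitian matrix with as many positive as negative eigenvalues, all of them nonzero, is
congruent to `i` times the canonical Poisson matrix. -/
lemma exists_congr_poisson {m : Type*} [Fintype m] [DecidableEq m]
    {H : Matrix (m ⊕ m) (m ⊕ m) ℂ} (hH : H.IsHermitian)
    (hpos : (Finset.univ.filter fun i => 0 < hH.eigenvalues i).card = Fintype.card m)
    (hneg : (Finset.univ.filter fun i => hH.eigenvalues i < 0).card = Fintype.card m) :
    ∃ M : Matrix (m ⊕ m) (m ⊕ m) ℂ,
      Mᴴ * H * M = Complex.I • Matrix.fromBlocks 0 1 (-1) 0 := by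
  obtain ⟨e, he1, he2⟩ := exists_perm_pos_neg hH.eigenvalues hpos hneg
  set U : Matrix (m ⊕ m) (m ⊕ m) ℂ := hH.eigenvectorUnitary.1 with hU
  have hspec : Uᴴ * H * U = diagonal (fun i => (hH.eigenvalues i : ℂ)) := by
    have h := hH.conjStarAlgAut_star_eigenvectorUnitary
    rwa [Unitary.conjStarAlgAut_star_apply] at h
  set d : m ⊕ m → ℂ := fun j => ((√(2 * |hH.eigenvalues (e j)|))⁻¹ : ℝ) with hd
  set C : Matrix (m ⊕ m) (m ⊕ m) ℂ :=
    fromBlocks 1 (Complex.I • 1) 1 (-(Complex.I • 1)) with hC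
  have hdiag : (diagonal d)ᴴ * (Uᴴ * H * U).submatrix e e * diagonal d =
      fromBlocks ((1 / 2 : ℂ) • 1) 0 0 (-((1 / 2 : ℂ) • 1)) := by
    rw [hspec, submatrix_diagonal_equiv, diagonal_conjTranspose, diagonal_mul_diagonal,
      diagonal_mul_diagonal, smul_one_eq_diagonal, diagonal_neg, fromBlocks_diagonal]
    congr 1
    have key : ∀ x : ℝ, x ≠ 0 → (√(2 * |x|))⁻¹ * x * (√(2 * |x|))⁻¹ = x / |x| / 2 := by
      intro x hx
      have h2 : √(2 * |x|) * √(2 * |x|) = 2 * |x| := Real.mul_self_sqrt (by positivity)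
      have h3 : (√(2 * |x|))⁻¹ * x * (√(2 * |x|))⁻¹ = x / (√(2 * |x|) * √(2 * |x|)) := by
        field_simp
      rw [h3, h2]
      field_simp
    have hval : ∀ j, star (d j) * (hH.eigenvalues (e j) : ℂ) * d j =
        ((hH.eigenvalues (e j) / |hH.eigenvalues (e j)| / 2 : ℝ) : ℂ) := by
      intro j
      have hne : hH.eigenvalues (e j) ≠ 0 := by
        rcases j with j | j
        · exact (he1 j).ne'
        · exact (he2 j).ne
      rw [← key _ hne]
      simp [hd]
    funext j
    refine (hval j).trans ?_
    rcases j with j | j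
    · rw [abs_of_pos (he1 j), div_self (he1 j).ne']
      simp
    · rw [abs_of_neg (he2 j), div_neg, div_self (he2 j).ne]
      simp [neg_div]
  refine ⟨U.submatrix id e * diagonal d * C, ?_⟩
  have hsub : (U.submatrix id e)ᴴ * H * U.submatrix id e = (Uᴴ * H * U).submatrix e e := by
    rw [conjTranspose_submatrix]
    ext i j
    simp [Matrix.mul_apply]
  calc _ = Cᴴ * ((diagonal d)ᴴ * ((U.submatrix id e)ᴴ * H * U.submatrix id e) *
        diagonal d) * C := by simp only [conjTranspose_mul, Matrix.mul_assoc]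
    _ = _ := by
      rw [hsub, hdiag, hC, fromBlocks_conjTranspose, fromBlocks_multiply, fromBlocks_multiply,
        fromBlocks_smul]
      congr 1 <;> simp [smul_smul, ← add_smul]
      all_goals module

/-- Existence of the symplectic matrices: if `i·Wᴴ J₂ₙ W` has exactly `k` positive
and `k` negative eigenvalues and `Vᴴ W` has rank `2k`, then there exist `Q₁, Q₂`
with `ran V ⊆ ran Q₁`, `ran W ⊆ ran Q₂`, `Q₁ᴴ Q₂ = I`, and `Q₂` is
`(J₂ₙ, 𝕁₂ₖ)`-symplectic for the canonical Poisson matrix `𝕁₂ₖ = [[0, I],[−I, 0]]`. -/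
theorem existence_of_symplectic_matrices
    (n k : ℕ)
    (Jn : Matrix (Fin (2 * n)) (Fin (2 * n)) ℂ) (hJnSkew : Jnᴴ = -Jn)
    (V W : Matrix (Fin (2 * n)) (Fin k ⊕ Fin k) ℂ)
    (hHerm : (Complex.I • (Wᴴ * Jn * W)).IsHermitian)
    (hpos : (Finset.univ.filter fun i => 0 < hHerm.eigenvalues i).card = k)
    (hneg : (Finset.univ.filter fun i => hHerm.eigenvalues i < 0).card = k)
    (hrank : (Vᴴ * W).rank = 2 * k) :
    ∃ Q₁ Q₂ : Matrix (Fin (2 * n)) (Fin k ⊕ Fin k) ℂ,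
      (∀ v : Fin k ⊕ Fin k → ℂ, ∃ w : Fin k ⊕ Fin k → ℂ, V *ᵥ v = Q₁ *ᵥ w) ∧
      (∀ v : Fin k ⊕ Fin k → ℂ, ∃ w : Fin k ⊕ Fin k → ℂ, W *ᵥ v = Q₂ *ᵥ w) ∧
      Q₁ᴴ * Q₂ = 1 ∧
      Q₂ᴴ * Jn * Q₂ = Matrix.fromBlocks 0 1 (-1) 0 := by
  obtain ⟨M, hM⟩ := exists_congr_poisson hHerm (by simpa using hpos) (by simpa using hneg)
  have hsymp : (W * M)ᴴ * Jn * (W * M) = Matrix.fromBlocks 0 1 (-1) 0 := by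
    rw [Matrix.mul_smul, Matrix.smul_mul] at hM
    have h := smul_right_injective _ Complex.I_ne_zero hM
    rw [← h]
    simp only [conjTranspose_mul, Matrix.mul_assoc]
  have hMunit : IsUnit M.det := by
    have hJ : (Complex.I • fromBlocks 0 1 (-1) 0 :
        Matrix (Fin k ⊕ Fin k) (Fin k ⊕ Fin k) ℂ) *
        (Complex.I • fromBlocks 0 1 (-1) 0) = 1 := by
      rw [Matrix.mul_smul, Matrix.smul_mul, smul_smul, fromBlocks_multiply]
      simp [fromBlocks_neg]
    refine Matrix.isUnit_det_of_left_inverse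
      (B := (Complex.I • fromBlocks 0 1 (-1) 0) * (Mᴴ * (Complex.I • (Wᴴ * Jn * W)))) ?_
    rw [Matrix.mul_assoc, hM, hJ]
  have hVW : IsUnit (Vᴴ * W).det := by
    rw [← Matrix.isUnit_iff_isUnit_det]
    rw [← Matrix.mulVec_surjective_iff_isUnit]
    refine (LinearMap.range_eq_top (f := (Vᴴ * W).mulVecLin)).mp
      (Submodule.eq_top_of_finrank_eq ?_)
    rw [← Matrix.rank, hrank, Module.finrank_fintype_fun_eq_card, Fintype.card_sum,
      Fintype.card_fin, two_mul]
  have hA : IsUnit (Vᴴ * W * M).det := by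
    rw [Matrix.det_mul]
    exact hVW.mul hMunit
  have hN : IsUnit ((Vᴴ * W * M)⁻¹ᴴ).det := by
    rw [Matrix.det_conjTranspose]
    exact (Matrix.isUnit_nonsing_inv_det _ hA).star
  refine ⟨V * (Vᴴ * W * M)⁻¹ᴴ, W * M, fun v => ⟨(Vᴴ * W * M)⁻¹ᴴ⁻¹ *ᵥ v, ?_⟩,
    fun v => ⟨M⁻¹ *ᵥ v, ?_⟩, ?_, hsymp⟩
  · rw [Matrix.mulVec_mulVec, Matrix.mul_nonsing_inv_cancel_right _ _ hN]
  · rw [Matrix.mulVec_mulVec, Matrix.mul_nonsing_inv_cancel_right _ _ hMunit]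
  · rw [conjTranspose_mul, conjTranspose_conjTranspose, Matrix.mul_assoc, ← Matrix.mul_assoc Vᴴ,
      Matrix.nonsing_inv_mul _ hA]
end

section
/- (Tangential rational interpolation by projection.) Let A ∈ ℂ^{n×n}, B ∈ ℂ^{n×p}, C ∈ ℂ^{p×n}, D ∈ ℂ^{p×p}, and let s₁,…,s_k ∈ ℂ be distinct points and u₁,…,u_k ∈ ℂ^p tangent directions such that each s_mI_n − A is invertible. Let V ∈ ℂ^{n×k} be the matrix whose m-th column is (s_mI_n − A)⁻¹Bu_m, and let W ∈ ℂ^{n×k} satisfy W*V = I_k. Define the reduced matrices A_r = W*AV, B_r = W*B, C_r = CV, D_r = D, and assume each s_mI_k − A_r is invertible. Then for every m = 1,…,k: C(s_mI_n − A)⁻¹Bu_m + Du_m = C_r(s_mI_k − A_r)⁻¹B_ru_m + D_ru_m, i.e. G(s_m)u_m = G_r(s_m)u_m where G(s) = C(sI_n − A)⁻¹B + D and G_r(s) = C_r(sI_k − A_r)⁻¹B_r + D_r. -/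
open Matrix

/-- Tangential rational interpolation by Petrov–Galerkin projection: if the `m`-th
column of `V` is `(s_m I − A)⁻¹ B u_m` and `Wᴴ V = I`, then the reduced system
`(A_r, B_r, C_r, D_r) = (WᴴAV, WᴴB, CV, D)` satisfies `G(s_m) u_m = G_r(s_m) u_m`. -/
theorem tangential_rational_interpolation
    (n k p : ℕ)
    (A : Matrix (Fin n) (Fin n) ℂ) (B : Matrix (Fin n) (Fin p) ℂ)
    (C : Matrix (Fin p) (Fin n) ℂ) (D : Matrix (Fin p) (Fin p) ℂ)
    (s : Fin k → ℂ) (hs : Function.Injective s)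
    (u : Fin k → Fin p → ℂ)
    (hinv : ∀ m, IsUnit (s m • (1 : Matrix (Fin n) (Fin n) ℂ) - A))
    (V W : Matrix (Fin n) (Fin k) ℂ)
    (hV : ∀ m, (fun i => V i m) =
      (s m • (1 : Matrix (Fin n) (Fin n) ℂ) - A)⁻¹ *ᵥ (B *ᵥ u m))
    (hW : Wᴴ * V = 1)
    (hinvr : ∀ m, IsUnit (s m • (1 : Matrix (Fin k) (Fin k) ℂ) - Wᴴ * A * V)) :
    ∀ m,
      C *ᵥ ((s m • (1 : Matrix (Fin n) (Fin n) ℂ) - A)⁻¹ *ᵥ (B *ᵥ u m)) + D *ᵥ u m =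
      (C * V) *ᵥ ((s m • (1 : Matrix (Fin k) (Fin k) ℂ) - Wᴴ * A * V)⁻¹ *ᵥ
        ((Wᴴ * B) *ᵥ u m)) + D *ᵥ u m := by
  intro m
  set x := (s m • (1 : Matrix (Fin n) (Fin n) ℂ) - A)⁻¹ *ᵥ (B *ᵥ u m) with hx
  have hVx : V *ᵥ Pi.single m 1 = x := by
    rw [mulVec_single_one]
    exact hV m
  have hBu : (s m • (1 : Matrix (Fin n) (Fin n) ℂ) - A) *ᵥ x = B *ᵥ u m := by
    rw [hx, mulVec_mulVec, mul_nonsing_inv _ ((isUnit_iff_isUnit_det _).mp (hinv m)), one_mulVec]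
  have hproj : s m • (1 : Matrix (Fin k) (Fin k) ℂ) - Wᴴ * A * V =
      Wᴴ * (s m • (1 : Matrix (Fin n) (Fin n) ℂ) - A) * V := by
    simp [Matrix.mul_sub, Matrix.sub_mul, hW]
  have hred : (Wᴴ * B) *ᵥ u m =
      (s m • (1 : Matrix (Fin k) (Fin k) ℂ) - Wᴴ * A * V) *ᵥ Pi.single m 1 := by
    simp only [hproj, ← mulVec_mulVec, hVx, hBu]
  rw [hred, mulVec_mulVec _ _ (_ - _),
    nonsing_inv_mul _ ((isUnit_iff_isUnit_det _).mp (hinvr m)), one_mulVec, ← mulVec_mulVec, hVx]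
end
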